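/- Let k ≥ 3 be an integer and let c be a real number with 0 < c < 1 such that for every x ∈ (0,1/2), c·ln(1+(1−2x)^k) < ln 2 + H(x) (i.e., c < θ_k). Then P_{n,⌊c·n⌋}(k-XOR-SAT) tends to 1 as n → ∞. -/

import Mathlib

open Finset Filter

attribute [local instance] Classical.propDecidable

/-- A `k`-XOR-clause over `n` variables: a `k`-element set of variables
together with a right-hand side in `GF(2) = ZMod 2`. -/
abbrev Clause (n k : ℕ) := {S : Finset (Fin n) // S.card = k} × ZMod 2

/-- A formula in `Ω(n,L,k)`: an ordered `L`-tuple of `k`-XOR-clauses. -/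
abbrev Formula (n L k : ℕ) := Fin L → Clause n k

/-- A formula is satisfiable iff some assignment satisfies every clause. -/
def Satisfiable {n L k : ℕ} (F : Formula n L k) : Prop :=
  ∃ I : Fin n → ZMod 2, ∀ i : Fin L, ∑ j ∈ (F i).1.1, I j = (F i).2

/-- The number of satisfiable formulas in `Ω(n,L,k)`. -/
noncomputable def numSat (n L k : ℕ) : ℕ :=
  Nat.card {F : Formula n L k // Satisfiable F}

/-- `P_{n,L}(k-XOR-SAT)`: the fraction of satisfiable formulas in `Ω(n,L,k)`,
whose total number is `(2 * C(n,k))^L`. -/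
noncomputable def Psat (n L k : ℕ) : ℝ :=
  (numSat n L k : ℝ) / (2 * (n.choose k : ℝ)) ^ L

/-- The entropy function `H(x) = x ln x + (1−x) ln(1−x)`. -/
noncomputable def Hent (x : ℝ) : ℝ := x * Real.log x + (1 - x) * Real.log (1 - x)

/-- The nontrivial real character of `ZMod 2`. -/
noncomputable def parityChar (a : ZMod 2) : ℝ := if a = 0 then 1 else -1

theorem parityChar_add (a b : ZMod 2) : parityChar (a + b) = parityChar a * parityChar b := by
  have h0 : ∀ a : ZMod 2, a = 0 ∨ a = 1 := by decide
  have h1 : (1 : ZMod 2) + 1 = 0 := by decide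
  rcases h0 a with rfl | rfl <;> rcases h0 b with rfl | rfl <;> simp [parityChar, h1]

theorem parityChar_sum {ι : Type*} (S : Finset ι) (D : ι → ZMod 2) :
    parityChar (∑ j ∈ S, D j) = ∏ j ∈ S, parityChar (D j) := by
  induction S using Finset.induction_on with
  | empty => simp [parityChar]
  | insert a S ha ih => rw [sum_insert ha, prod_insert ha, parityChar_add, ih]

theorem parityChar_mul_self (a : ZMod 2) : parityChar a * parityChar a = 1 := by
  unfold parityChar; split_ifs <;> norm_num

theorem abs_parityChar (a : ZMod 2) : |parityChar a| = 1 := by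
  unfold parityChar; split_ifs <;> norm_num

/-- The `k`-th elementary symmetric function of the signs of `D`, over the index set `A`. -/
noncomputable def signEsymm {ι : Type*} (A : Finset ι) (D : ι → ZMod 2) (k : ℕ) : ℝ :=
  ∑ S ∈ A.powersetCard k, ∏ j ∈ S, parityChar (D j)

theorem signEsymm_zero {ι : Type*} (A : Finset ι) (D : ι → ZMod 2) : signEsymm A D 0 = 1 := by
  simp [signEsymm]

theorem signEsymm_one {ι : Type*} (A : Finset ι) (D : ι → ZMod 2) :
    signEsymm A D 1 = ∑ j ∈ A, parityChar (D j) := by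
  simp [signEsymm, powersetCard_one]

theorem signEsymm_insert {ι : Type*} {A : Finset ι} {a : ι} (ha : a ∉ A) (D : ι → ZMod 2)
    (k : ℕ) : signEsymm (insert a A) D (k + 1) =
      signEsymm A D (k + 1) + parityChar (D a) * signEsymm A D k := by
  unfold signEsymm
  have hnot : ∀ S ∈ A.powersetCard k, a ∉ S := fun S hS h =>
    ha ((mem_powersetCard.1 hS).1 h)
  rw [powersetCard_succ_insert ha, sum_union, sum_image, mul_sum]
  · congr 1
    exact sum_congr rfl fun S hS => prod_insert (hnot S hS)
  · intro S hS T hT h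
    have := congrArg (fun U => U.erase a) h
    simpa [erase_insert (hnot S hS), erase_insert (hnot T hT)] using this
  · rw [disjoint_left]
    intro S hS hS'
    obtain ⟨T, -, rfl⟩ := mem_image.1 hS'
    exact ha ((mem_powersetCard.1 hS).1 (mem_insert_self a T))

theorem signEsymm_recurrence {ι : Type*} (A : Finset ι) (D : ι → ZMod 2) (k : ℕ) :
    ((k : ℝ) + 2) * signEsymm A D (k + 2) =
      signEsymm A D 1 * signEsymm A D (k + 1) - ((#A : ℝ) - k) * signEsymm A D k := by
  induction A using Finset.induction_on generalizing k with
  | empty =>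
    have h : ∀ m, signEsymm (∅ : Finset ι) D (m + 1) = 0 := fun m => by
      rw [signEsymm, powersetCard_eq_empty.2 (by simp), sum_empty]
    rw [h, h k]
    rcases k with _ | k
    · simp
    · simp [h]
  | insert a A ha ih =>
    have h1 := parityChar_mul_self (D a)
    have hone : signEsymm (insert a A) D 1 = signEsymm A D 1 + parityChar (D a) := by
      have := signEsymm_insert ha D 0
      rwa [signEsymm_zero, mul_one] at this
    rw [card_insert_of_notMem ha, hone, signEsymm_insert ha (k := k + 1),
      signEsymm_insert ha (k := k)]
    rcases k with _ | k
    · have h2 := ih 0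
      simp only [signEsymm_zero, zero_add] at h2 ⊢
      push_cast at h2 ⊢
      linear_combination h2 - h1
    · have h2 := ih (k + 1)
      have h3 := ih k
      rw [signEsymm_insert ha]
      push_cast at h2 h3 ⊢
      linear_combination h2 + parityChar (D a) * h3 - signEsymm A D (k + 1) * h1

theorem abs_signEsymm_le_choose {ι : Type*} (A : Finset ι) (D : ι → ZMod 2) (k : ℕ) :
    |signEsymm A D k| ≤ (#A).choose k := by
  refine (abs_sum_le_sum_abs _ _).trans ?_
  simp [abs_prod, abs_parityChar]

theorem signEsymm_one_eq {n : ℕ} (D : Fin n → ZMod 2) :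
    signEsymm univ D 1 = n - 2 * (#{j | D j ≠ 0} : ℝ) := by
  have h : ∀ a : ZMod 2, parityChar a = 1 - 2 * (if a ≠ 0 then 1 else 0) := by
    intro a
    unfold parityChar
    by_cases h : a = 0 <;> simp [h]; norm_num
  rw [signEsymm_one, card_eq_sum_ones, Nat.cast_sum, sum_filter]
  rw [sum_congr rfl fun j _ => h (D j), sum_sub_distrib, ← mul_sum]
  simp

theorem sum_apply_card_support (n : ℕ) (f : ℕ → ℝ) :
    ∑ D : Fin n → ZMod 2, f #{j | D j ≠ 0} = ∑ w ∈ range (n + 1), (n.choose w : ℝ) * f w := by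
  have h0 : ∀ a : ZMod 2, a ≠ 0 → a = 1 := by decide
  have := sum_powerset_apply_card (α := ℝ) f (x := (univ : Finset (Fin n)))
  simp only [card_univ, Fintype.card_fin, nsmul_eq_mul] at this
  rw [← this]
  refine sum_bij' (fun D _ => ({j | D j ≠ 0} : Finset (Fin n)))
    (fun T _ j => if j ∈ T then 1 else 0) ?_ ?_ ?_ ?_ ?_
  · simp
  · simp
  · intro D _
    ext1 j
    by_cases h : D j = 0
    · simp [h]
    · simp [h0 _ h]
  · intro T _
    ext j
    simp
  · simp

/-- The indicator that the assignment `I` satisfies the clause `C`. -/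
noncomputable def satIndicator {n k : ℕ} (I : Fin n → ZMod 2) (C : Clause n k) : ℝ :=
  if ∑ j ∈ C.1.1, I j = C.2 then 1 else 0

theorem sum_satIndicator {n k : ℕ} (I : Fin n → ZMod 2) :
    ∑ C : Clause n k, satIndicator I C = n.choose k := by
  rw [Fintype.sum_prod_type]
  simp [satIndicator]

theorem sum_satIndicator_mul {n k : ℕ} (I J : Fin n → ZMod 2) :
    ∑ C : Clause n k, satIndicator I C * satIndicator J C =
      ((n.choose k : ℝ) + signEsymm univ (I - J) k) / 2 := by
  have h : ∀ S : {S : Finset (Fin n) // S.card = k},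
      ∑ b : ZMod 2, satIndicator I (S, b) * satIndicator J (S, b) =
        (1 + ∏ j ∈ S.1, parityChar ((I - J) j)) / 2 := by
    intro S
    rw [← parityChar_sum]
    simp only [Pi.sub_apply, sum_sub_distrib, satIndicator, parityChar, sub_eq_zero]
    by_cases hIJ : ∑ j ∈ S.1, I j = ∑ j ∈ S.1, J j
    · simp [hIJ]
    · simp [hIJ]
  rw [Fintype.sum_prod_type, sum_congr rfl fun S _ => h S, ← sum_div, sum_add_distrib]
  congr 2
  · simp
  · rw [signEsymm]
    have hmem : ∀ S : Finset (Fin n), S ∈ univ.powersetCard k ↔ S.card = k := fun S => by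
      simp [mem_powersetCard]
    exact (sum_subtype _ hmem fun S => ∏ j ∈ S, parityChar ((I - J) j)).symm

/-- The second-moment ratio: the average of `(1 + κ)^L` over all assignments, where `κ` is the
normalized elementary symmetric function of the signs. -/
noncomputable def momentRatio (n L k : ℕ) : ℝ :=
  (∑ D : Fin n → ZMod 2, (1 + signEsymm univ D k / n.choose k) ^ L) / 2 ^ n

theorem one_le_Psat_mul_momentRatio {n L k : ℕ} (hkn : k ≤ n) :
    1 ≤ Psat n L k * momentRatio n L k := by
  have hN : (0 : ℝ) < n.choose k := by exact_mod_cast Nat.choose_pos hkn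
  set N : ℝ := (n.choose k : ℝ) with hNdef
  let X : Formula n L k → ℝ := fun F => ∑ I : Fin n → ZMod 2, ∏ i, satIndicator I (F i)
  have hX1 : ∑ F, X F = 2 ^ n * N ^ L := by
    simp only [X]
    rw [sum_comm]
    simp only [← Fintype.sum_pow, sum_satIndicator]
    simp [N]
  have hX2 : ∑ F, X F ^ 2 = 2 ^ n * (N / 2) ^ L * (2 ^ n * momentRatio n L k) := by
    simp only [X, sq, sum_mul_sum, ← prod_mul_distrib]
    rw [sum_comm]
    have : ∀ I : Fin n → ZMod 2, ∑ F : Formula n L k, ∑ J : Fin n → ZMod 2,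
        ∏ i, satIndicator I (F i) * satIndicator J (F i) =
        ∑ D : Fin n → ZMod 2, (N / 2) ^ L * (1 + signEsymm univ D k / N) ^ L := by
      intro I
      rw [sum_comm, ← Equiv.sum_comp (Equiv.subLeft I)]
      refine sum_congr rfl fun J _ => ?_
      rw [← Fintype.sum_pow (fun C : Clause n k => satIndicator I C * satIndicator _ C),
        sum_satIndicator_mul, ← mul_pow, Equiv.subLeft_apply, sub_sub_cancel]
      congr 1
      rw [← hNdef]
      field_simp
    rw [sum_congr rfl fun I _ => this I, ← mul_sum, momentRatio]
    simp only [← hNdef, ← mul_sum, sum_const, card_univ, Fintype.card_fun, Fintype.card_fin,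
      ZMod.card, nsmul_eq_mul]
    push_cast
    field_simp
  have hzero : ∀ F, ¬ Satisfiable F → X F = 0 := by
    intro F hF
    refine sum_eq_zero fun I _ => ?_
    by_contra h
    refine hF ⟨I, fun i => ?_⟩
    have := (prod_ne_zero_iff.1 h) i (mem_univ i)
    simpa [satIndicator] using this
  have hcs : (∑ F, X F) ^ 2 ≤ numSat n L k * ∑ F, X F ^ 2 := by
    have h1 : ∑ F, X F = ∑ F with Satisfiable F, X F := by
      rw [sum_filter]
      exact sum_congr rfl fun F _ => by
        by_cases h : Satisfiable F <;> simp [h, hzero]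
    have h2 : numSat n L k = #{F : Formula n L k | Satisfiable F} := by
      rw [numSat, Nat.card_eq_fintype_card, Fintype.card_subtype]
    rw [h1, h2]
    refine sq_sum_le_card_mul_sum_sq.trans ?_
    gcongr
    exact subset_univ _
  rw [hX1, hX2] at hcs
  rw [Psat, div_mul_eq_mul_div, le_div_iff₀ (by positivity), one_mul]
  have hp : (0 : ℝ) < (2 ^ n) ^ 2 * (N / 2) ^ L := by positivity
  refine le_of_mul_le_mul_left ?_ hp
  calc _ = (2 ^ n * N ^ L) ^ 2 := by
        rw [mul_assoc, ← mul_pow, show N / 2 * (2 * N) = N ^ 2 by ring]; ring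
    _ ≤ _ := hcs
    _ = _ := by ring

theorem Psat_le_one {n L k : ℕ} (hkn : k ≤ n) : Psat n L k ≤ 1 := by
  have hN : (0 : ℝ) < n.choose k := by exact_mod_cast Nat.choose_pos hkn
  rw [Psat, div_le_one (by positivity)]
  have h : numSat n L k ≤ Nat.card (Formula n L k) := by
    exact Nat.card_le_card_of_injective _ Subtype.val_injective
  have h2 : Nat.card (Formula n L k) = (2 * n.choose k) ^ L := by
    simp [mul_comm]
  rw [h2] at h
  exact_mod_cast h

theorem abs_signEsymm_one_le {n : ℕ} (D : Fin n → ZMod 2) : |signEsymm univ D 1| ≤ n := by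
  simpa using abs_signEsymm_le_choose univ D 1

theorem abs_signEsymm_le_pow {n : ℕ} (D : Fin n → ZMod 2) {k : ℕ} (hk : k ≤ n) :
    |signEsymm univ D k| ≤ (|signEsymm univ D 1| + √n) ^ k := by
  induction k using Nat.strong_induction_on with
  | _ k ih =>
    match k, hk, ih with
    | 0, _, _ => simp [signEsymm_zero]
    | 1, _, _ => simp
    | k + 2, hk, ih =>
      have h1 := ih (k + 1) (by omega) (by omega)
      have h0 := ih k (by omega) (by omega)
      have hrec := signEsymm_recurrence univ D k
      have hkn : (k : ℝ) ≤ n := by exact_mod_cast (by omega : k ≤ n)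
      rw [card_univ, Fintype.card_fin] at hrec
      have hn : √(n : ℝ) * √n = n := Real.mul_self_sqrt (Nat.cast_nonneg n)
      set s := signEsymm univ D 1
      set q := √(n : ℝ)
      have hq : 0 ≤ q := Real.sqrt_nonneg _
      have hs : 0 ≤ |s| := abs_nonneg s
      have hk0 : (0 : ℝ) ≤ k := Nat.cast_nonneg k
      calc |signEsymm univ D (k + 2)|
          ≤ ((k : ℝ) + 2) * |signEsymm univ D (k + 2)| :=
            le_mul_of_one_le_left (abs_nonneg _) (by linarith)
        _ = |s * signEsymm univ D (k + 1) - ((n : ℝ) - k) * signEsymm univ D k| := by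
            rw [← hrec, abs_mul, abs_of_nonneg (by linarith : (0 : ℝ) ≤ k + 2)]
        _ ≤ |s| * |signEsymm univ D (k + 1)| + ((n : ℝ) - k) * |signEsymm univ D k| := by
            refine (abs_sub _ _).trans ?_
            rw [abs_mul, abs_mul, abs_of_nonneg (by linarith : (0 : ℝ) ≤ n - k)]
        _ ≤ |s| * (|s| + q) ^ (k + 1) + n * (|s| + q) ^ k := by
            gcongr
            linarith
        _ ≤ (|s| + q) ^ (k + 2) := by
            have hp : 0 ≤ (|s| + q) ^ k := by positivity
            have : 0 ≤ (|s| + q) ^ k * (|s| * q) := by positivity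
            rw [← hn, pow_succ, pow_add]
            nlinarith

theorem exists_abs_factorial_mul_signEsymm_sub_pow_le (k : ℕ) :
    ∃ C : ℝ, 0 ≤ C ∧ ∀ (n : ℕ) (D : Fin n → ZMod 2), k ≤ n →
      n * |(k.factorial : ℝ) * signEsymm univ D k - signEsymm univ D 1 ^ k| ≤ C * n ^ k := by
  induction k using Nat.strong_induction_on with
  | _ k ih =>
    match k, ih with
    | 0, _ => exact ⟨0, le_rfl, fun n D _ => by simp [signEsymm_zero]⟩
    | 1, _ => exact ⟨0, le_rfl, fun n D _ => by simp⟩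
    | k + 2, ih =>
      obtain ⟨C, hC, h⟩ := ih (k + 1) (by omega)
      refine ⟨C + (k + 1), by positivity, fun n D hkn => ?_⟩
      have h1 := h n D (by omega)
      have hrec := signEsymm_recurrence univ D k
      have hkn' : (k : ℝ) ≤ n := by exact_mod_cast (by omega : k ≤ n)
      rw [card_univ, Fintype.card_fin] at hrec
      have hs := abs_signEsymm_one_le D
      have hk0 : (k.factorial : ℝ) * |signEsymm univ D k| ≤ (n : ℝ) ^ k := by
        calc _ ≤ (k.factorial : ℝ) * (n.choose k : ℝ) := by
              gcongr
              simpa using abs_signEsymm_le_choose univ D k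
          _ = (n.descFactorial k : ℝ) := by
              rw [Nat.descFactorial_eq_factorial_mul_choose]; push_cast; ring
          _ ≤ _ := by exact_mod_cast Nat.descFactorial_le_pow n k
      set s := signEsymm univ D 1
      have hfac : ((k + 2).factorial : ℝ) * signEsymm univ D (k + 2) - s ^ (k + 2) =
          s * (((k + 1).factorial : ℝ) * signEsymm univ D (k + 1) - s ^ (k + 1)) -
            (k + 1) * (n - k) * (k.factorial * signEsymm univ D k) := by
        rw [Nat.factorial_succ (k + 1), Nat.factorial_succ k]
        push_cast
        linear_combination ((k : ℝ) + 1) * k.factorial * hrec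
      rw [hfac]
      calc _ ≤ (n : ℝ) * (|s| * |((k + 1).factorial : ℝ) * signEsymm univ D (k + 1) - s ^ (k + 1)|
            + (k + 1) * (n - k) * (k.factorial * |signEsymm univ D k|)) := by
            gcongr
            refine (abs_sub _ _).trans ?_
            rw [abs_mul s, abs_mul ((k + 1) * _ : ℝ), abs_mul (k.factorial : ℝ), Nat.abs_cast,
              abs_of_nonneg (mul_nonneg (by positivity) (by linarith) : (0 : ℝ) ≤ (k + 1) * (n - k))]
        _ ≤ (n : ℝ) * (n * |((k + 1).factorial : ℝ) * signEsymm univ D (k + 1) - s ^ (k + 1)|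
            + (k + 1) * n * n ^ k) := by
            gcongr
            linarith
        _ ≤ (n : ℝ) * (C * n ^ (k + 1) + (k + 1) * n * n ^ k) := by gcongr
        _ = _ := by ring

theorem eventually_signEsymm_div_choose_le (k : ℕ) {ε : ℝ} (hε : 0 < ε) :
    ∀ᶠ n : ℕ in atTop, ∀ D : Fin n → ZMod 2,
      signEsymm univ D k / n.choose k ≤ |signEsymm univ D 1 / n| ^ k + ε := by
  obtain ⟨C, hC, h⟩ := exists_abs_factorial_mul_signEsymm_sub_pow_le k
  have hlim : Tendsto (fun n : ℕ => (n : ℝ) ^ k / n.descFactorial k) atTop (nhds 1) := by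
    have hz : ∀ᶠ n : ℕ in atTop, (n.descFactorial k : ℝ) ≠ 0 := by
      filter_upwards [eventually_ge_atTop k] with n hn
      exact_mod_cast (Nat.descFactorial_pos.2 hn).ne'
    exact (Asymptotics.isEquivalent_iff_tendsto_one hz).1 (isEquivalent_descFactorial k).symm
  have hlim2 : Tendsto (fun n : ℕ => (n : ℝ) ^ k / n.descFactorial k - 1 +
      C / n * ((n : ℝ) ^ k / n.descFactorial k)) atTop (nhds 0) := by
    simpa using (hlim.sub_const 1).add ((tendsto_const_div_atTop_nhds_zero_nat C).mul hlim)
  filter_upwards [hlim2.eventually_le_const hε, eventually_ge_atTop k, eventually_gt_atTop 0]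
    with n hn hkn hn0 D
  have hn0' : (0 : ℝ) < n := by exact_mod_cast hn0
  have hd : (0 : ℝ) < n.descFactorial k := by exact_mod_cast Nat.descFactorial_pos.2 hkn
  have hfac : (n.descFactorial k : ℝ) = k.factorial * n.choose k := by
    exact_mod_cast Nat.descFactorial_eq_factorial_mul_choose n k
  have hle : (n : ℝ) ^ k / n.descFactorial k ≥ 1 := by
    rw [ge_iff_le, one_le_div hd]
    exact_mod_cast Nat.descFactorial_le_pow n k
  have hz : |signEsymm univ D 1 / n| ^ k ≤ 1 := by
    refine pow_le_one₀ (abs_nonneg _) ?_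
    rw [abs_div, Nat.abs_cast, div_le_one hn0']
    exact abs_signEsymm_one_le D
  have hb : (k.factorial : ℝ) * signEsymm univ D k ≤
      (|signEsymm univ D 1 / n| ^ k + C / n) * n ^ k := by
    have h1 := h n D hkn
    rw [← le_div_iff₀' hn0'] at h1
    have h2 := (le_abs_self _).trans h1
    have h3 : signEsymm univ D 1 ^ k ≤ |signEsymm univ D 1 / n| ^ k * n ^ k := by
      rw [← mul_pow, abs_div, Nat.abs_cast, div_mul_cancel₀ _ hn0'.ne', ← abs_pow]
      exact le_abs_self _
    have h4 : C * (n : ℝ) ^ k / n = C / n * n ^ k := by ring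
    linarith
  calc signEsymm univ D k / n.choose k
      = (k.factorial : ℝ) * signEsymm univ D k / n.descFactorial k := by
        rw [hfac, mul_div_mul_left _ _ (by positivity)]
    _ ≤ (|signEsymm univ D 1 / n| ^ k + C / n) * n ^ k / n.descFactorial k := by gcongr
    _ = |signEsymm univ D 1 / n| ^ k + |signEsymm univ D 1 / n| ^ k *
          ((n : ℝ) ^ k / n.descFactorial k - 1) +
          C / n * ((n : ℝ) ^ k / n.descFactorial k) := by ring
    _ ≤ |signEsymm univ D 1 / n| ^ k + 1 * ((n : ℝ) ^ k / n.descFactorial k - 1) +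
          C / n * ((n : ℝ) ^ k / n.descFactorial k) := by
        gcongr
    _ ≤ _ := by linarith

theorem exists_signEsymm_div_choose_le_cube {k : ℕ} (hk : 3 ≤ k) :
    ∃ C : ℝ, 0 < C ∧ ∀ᶠ n : ℕ in atTop, ∀ D : Fin n → ZMod 2,
      signEsymm univ D k / n.choose k ≤ C * ((|signEsymm univ D 1| + √n) / n) ^ 3 := by
  refine ⟨k.factorial * 2 ^ k * 2 ^ (k - 3), by positivity, ?_⟩
  filter_upwards [eventually_ge_atTop (2 * k)] with n hn D
  have hn0 : 0 < n := by omega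
  have hn1 : (1 : ℝ) ≤ n := by exact_mod_cast hn0
  have hN : ((n : ℝ) / 2) ^ k / k.factorial ≤ n.choose k := by
    refine le_trans ?_ (Nat.pow_le_choose k n)
    gcongr
    rw [Nat.cast_sub (by omega)]
    have : (2 : ℝ) * k ≤ n := by exact_mod_cast hn
    push_cast
    linarith
  have hs := abs_signEsymm_one_le D
  have hq : √(n : ℝ) ≤ n := by
    rw [Real.sqrt_le_left (by linarith)]
    nlinarith
  have he := (le_abs_self _).trans (abs_signEsymm_le_pow D (by omega : k ≤ n))
  set b := |signEsymm univ D 1| + √(n : ℝ)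
  have hb0 : 0 ≤ b := by positivity
  have hb : b / n ≤ 2 := by
    rw [div_le_iff₀ (by linarith)]
    linarith
  calc _ ≤ b ^ k / (((n : ℝ) / 2) ^ k / k.factorial) := by gcongr
    _ = k.factorial * 2 ^ k * (b / n) ^ (k - 3) * (b / n) ^ 3 := by
        rw [mul_assoc _ _ ((b / n) ^ 3), ← pow_add, Nat.sub_add_cancel hk]
        rw [div_pow, div_pow]
        field_simp
    _ ≤ _ := by gcongr

theorem choose_le_exp_neg_Hent {n w : ℕ} (hw : w ≤ n) (hn : 0 < n) :
    (n.choose w : ℝ) ≤ Real.exp (-(n * Hent (w / n))) := by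
  have hn' : (0 : ℝ) < n := by exact_mod_cast hn
  rcases Nat.eq_zero_or_pos w with rfl | hw0
  · simp [Hent]
  rcases hw.eq_or_lt with rfl | hwn
  · simp [Hent, hn'.ne']
  have hw0' : (0 : ℝ) < w := by exact_mod_cast hw0
  have hwn' : (w : ℝ) < n := by exact_mod_cast hwn
  have hx0 : (0 : ℝ) < w / n := by positivity
  have hx1 : (0 : ℝ) < 1 - w / n := by rw [sub_pos, div_lt_one hn']; exact hwn'
  have hterm : ((w : ℝ) / n) ^ w * (1 - w / n) ^ (n - w) * n.choose w ≤ 1 := by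
    have := add_pow ((w : ℝ) / n) (1 - w / n) n
    rw [add_sub_cancel, one_pow] at this
    refine le_of_le_of_eq ?_ this.symm
    exact single_le_sum (f := fun m => ((w : ℝ) / n) ^ m * (1 - w / n) ^ (n - m) * n.choose m)
      (fun m _ => by positivity) (mem_range.2 (by omega))
  have hexp : Real.exp (n * Hent (w / n)) = ((w : ℝ) / n) ^ w * (1 - w / n) ^ (n - w) := by
    have h0 : ((w : ℝ) / n) ^ w = Real.exp (w * Real.log (w / n)) := by
      rw [Real.exp_nat_mul, Real.exp_log hx0]
    have h1 : (1 - (w : ℝ) / n) ^ (n - w) =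
        Real.exp ((n - w : ℕ) * Real.log (1 - w / n)) := by
      rw [Real.exp_nat_mul, Real.exp_log hx1]
    rw [h0, h1, ← Real.exp_add, Hent, Nat.cast_sub hw]
    congr 1
    field_simp
  rw [Real.exp_neg, hexp, ← one_div, le_div_iff₀ (by positivity)]
  linarith

theorem choose_le_two_pow_mul_exp {n w : ℕ} (hw : w ≤ n) (hn : 0 < n) :
    (n.choose w : ℝ) ≤ 2 ^ n * Real.exp (-((n - 2 * w : ℝ) ^ 2 / (2 * n))) := by
  have hn' : (0 : ℝ) < n := by exact_mod_cast hn
  set t : ℝ := (n - 2 * w) / n with ht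
  have hsum : Real.exp (-t) ^ w * Real.exp t ^ (n - w) * n.choose w ≤
      (2 * Real.cosh t) ^ n := by
    rw [Real.cosh_eq, mul_div_cancel₀ _ two_ne_zero, add_comm, add_pow]
    exact single_le_sum (f := fun m => Real.exp (-t) ^ m * Real.exp t ^ (n - m) * n.choose m)
      (fun m _ => by positivity) (mem_range.2 (by omega))
  have hcosh : (2 * Real.cosh t) ^ n ≤ 2 ^ n * Real.exp (n * (t ^ 2 / 2)) := by
    rw [mul_pow, Real.exp_nat_mul]
    gcongr
    exact Real.cosh_le_exp_half_sq t
  have hexp : Real.exp (-t) ^ w * Real.exp t ^ (n - w) =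
      Real.exp ((n - 2 * w : ℝ) ^ 2 / n) := by
    rw [← Real.exp_nat_mul, ← Real.exp_nat_mul, ← Real.exp_add, Nat.cast_sub hw, ht]
    congr 1
    field_simp
    ring
  have h := hsum.trans hcosh
  rw [hexp, mul_comm, ← le_div_iff₀ (Real.exp_pos _), mul_div_assoc, ← Real.exp_sub] at h
  refine h.trans_eq ?_
  congr 2
  rw [ht]
  field_simp
  ring

theorem exists_gap_of_lt_theta {k : ℕ} {c : ℝ} (hc1 : c < 1)
    (hθ : ∀ x : ℝ, 0 < x → x < 1 / 2 →
      c * Real.log (1 + (1 - 2 * x) ^ k) < Real.log 2 + Hent x) {δ : ℝ} (hδ : 0 < δ) :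
    ∃ η : ℝ, 0 < η ∧ ∀ x : ℝ, 0 ≤ x → x ≤ 1 → δ ≤ |1 - 2 * x| →
      c * Real.log (1 + |1 - 2 * x| ^ k) + η ≤ Real.log 2 + Hent x := by
  have hl2 : 0 < Real.log 2 := Real.log_pos one_lt_two
  have hsymm : ∀ x, Hent (1 - x) = Hent x := fun x => by
    simp only [Hent, sub_sub_cancel]
    ring
  have hleft : ∀ x : ℝ, 0 ≤ x → x < 1 / 2 →
      c * Real.log (1 + |1 - 2 * x| ^ k) < Real.log 2 + Hent x := by
    intro x hx0 hx
    rw [abs_of_pos (by linarith)]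
    rcases hx0.eq_or_lt with rfl | hx0
    · norm_num [Hent]
      nlinarith
    · exact hθ x hx0 hx
  have hpos : ∀ x : ℝ, 0 ≤ x → x ≤ 1 → δ ≤ |1 - 2 * x| →
      0 < Real.log 2 + Hent x - c * Real.log (1 + |1 - 2 * x| ^ k) := by
    intro x hx0 hx1 hx
    rcases lt_trichotomy x (1 / 2) with h | rfl | h
    · linarith [hleft x hx0 h]
    · norm_num at hx
      linarith
    · have := hleft (1 - x) (by linarith) (by linarith)
      rw [hsymm, show 1 - 2 * (1 - x) = -(1 - 2 * x) by ring, abs_neg] at this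
      linarith
  have hcont : Continuous fun x : ℝ =>
      Real.log 2 + Hent x - c * Real.log (1 + |1 - 2 * x| ^ k) := by
    have hH : Continuous Hent := by
      have h := Real.continuous_mul_log
      exact h.add (h.comp (continuous_const.sub continuous_id))
    have hlog : Continuous fun x : ℝ => Real.log (1 + |1 - 2 * x| ^ k) :=
      Continuous.log (by fun_prop) fun x => by positivity
    fun_prop
  let K : Set ℝ := Set.Icc 0 1 ∩ {x | δ ≤ |1 - 2 * x|}
  have hK : IsCompact K :=
    isCompact_Icc.inter_right (isClosed_le continuous_const (by fun_prop))
  rcases K.eq_empty_or_nonempty with hne | hne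
  · refine ⟨1, one_pos, fun x h0 h1 h => ?_⟩
    have : x ∈ K := ⟨⟨h0, h1⟩, h⟩
    simp [hne] at this
  · obtain ⟨y, hy, hmin⟩ := hK.exists_isMinOn hne hcont.continuousOn
    refine ⟨_, hpos y hy.1.1 hy.1.2 hy.2, fun x h0 h1 h => ?_⟩
    have := hmin (show x ∈ K from ⟨⟨h0, h1⟩, h⟩)
    simp only [Set.mem_ofPred_eq] at this
    linarith

theorem momentRatio_le {n L k : ℕ} {α β : ℝ}
    (h : ∀ D : Fin n → ZMod 2, (1 + signEsymm univ D k / n.choose k) ^ L ≤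
      α + β * (2 ^ n / n.choose #{j | D j ≠ 0})) :
    momentRatio n L k ≤ α + β * (n + 1) := by
  rw [momentRatio, div_le_iff₀ (by positivity)]
  refine (sum_le_sum fun D _ => h D).trans_eq ?_
  have hsum := sum_apply_card_support n fun w => (2 : ℝ) ^ n / n.choose w
  have hone : ∑ w ∈ range (n + 1), (n.choose w : ℝ) * (2 ^ n / n.choose w) =
      ∑ w ∈ range (n + 1), (2 : ℝ) ^ n := by
    refine sum_congr rfl fun w hw => ?_
    have : (0 : ℝ) < n.choose w := by
      exact_mod_cast Nat.choose_pos (Nat.lt_succ_iff.1 (mem_range.1 hw))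
    field_simp
  rw [sum_add_distrib, ← mul_sum, hsum, hone]
  simp
  ring

theorem one_add_pow_floor_le_exp {x c : ℝ} {n : ℕ} (hx : 0 ≤ 1 + x) (hc1 : c < 1)
    {y : ℝ} (hy : 0 ≤ y) (hxy : x ≤ y) : (1 + x) ^ ⌊c * n⌋₊ ≤ Real.exp (n * y) := by
  have hL : ⌊c * n⌋₊ ≤ n := Nat.floor_le_of_le (by nlinarith [(Nat.cast_nonneg n : (0 : ℝ) ≤ n)])
  calc (1 + x) ^ ⌊c * n⌋₊ ≤ Real.exp y ^ ⌊c * n⌋₊ := by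
        gcongr
        linarith [Real.add_one_le_exp y]
    _ ≤ Real.exp y ^ n := pow_le_pow_right₀ (Real.one_le_exp hy) hL
    _ = _ := (Real.exp_nat_mul y n).symm

theorem one_add_pow_floor_le_of_gap {x c z η h : ℝ} {n : ℕ} (hx : 0 ≤ 1 + x) (hc0 : 0 < c)
    (hc1 : c < 1) (hz : 0 ≤ z) (hη : 0 < η) (hxz : x ≤ z + η / 2)
    (hgap : c * Real.log (1 + z) + η ≤ Real.log 2 + h) :
    (1 + x) ^ ⌊c * n⌋₊ ≤ Real.exp (-(η / 2 * n)) * (2 ^ n * Real.exp (n * h)) := by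
  have hL : (⌊c * n⌋₊ : ℝ) ≤ c * n := Nat.floor_le (by positivity)
  have hL0 : (0 : ℝ) ≤ ⌊c * n⌋₊ := Nat.cast_nonneg _
  have hlog : 0 ≤ Real.log (1 + z) := Real.log_nonneg (by linarith)
  have hn : (0 : ℝ) ≤ n := Nat.cast_nonneg n
  have hbase : 1 + x ≤ Real.exp (Real.log (1 + z) + η / 2) := by
    rw [Real.exp_add, Real.exp_log (by linarith)]
    nlinarith [Real.add_one_le_exp (η / 2)]
  calc (1 + x) ^ ⌊c * n⌋₊ ≤ Real.exp (Real.log (1 + z) + η / 2) ^ ⌊c * n⌋₊ := by gcongr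
    _ = Real.exp (⌊c * n⌋₊ * (Real.log (1 + z) + η / 2)) := (Real.exp_nat_mul _ _).symm
    _ ≤ Real.exp (-(η / 2 * n) + (n * Real.log 2 + n * h)) := by
        gcongr
        calc _ ≤ c * n * (Real.log (1 + z) + η / 2) := by gcongr
          _ = n * (c * Real.log (1 + z) + c * (η / 2)) := by ring
          _ ≤ n * (Real.log 2 + h - η / 2) := by
              gcongr
              nlinarith
          _ = _ := by ring
    _ = _ := by rw [Real.exp_add, Real.exp_add, Real.exp_nat_mul, Real.exp_log two_pos]

theorem exists_momentRatio_le {k : ℕ} (hk : 3 ≤ k) {c : ℝ} (hc0 : 0 < c) (hc1 : c < 1)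
    (hθ : ∀ x : ℝ, 0 < x → x < 1 / 2 →
      c * Real.log (1 + (1 - 2 * x) ^ k) < Real.log 2 + Hent x) :
    ∃ C η : ℝ, 0 < η ∧ ∀ᶠ n : ℕ in atTop, ∀ r : ℝ, 0 < r → r ^ 5 = n →
      momentRatio n ⌊c * n⌋₊ k ≤ Real.exp (C / r) +
        (Real.exp (-(1 / 4 * r)) + Real.exp (-(η * n))) * (n + 1) := by
  obtain ⟨C, hC, hcube⟩ := exists_signEsymm_div_choose_le_cube hk
  obtain ⟨η, hη, hgap⟩ := exists_gap_of_lt_theta hc1 hθ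
    (show (0 : ℝ) < 1 / (32 * C) by positivity)
  refine ⟨8 * C, η / 2, by positivity, ?_⟩
  filter_upwards [hcube, eventually_signEsymm_div_choose_le k (half_pos hη),
    eventually_ge_atTop k, eventually_gt_atTop 0] with n hcube hpow hkn hn0 r hr0 hrn
  have hn0' : (0 : ℝ) < n := by exact_mod_cast hn0
  have hn1 : (1 : ℝ) ≤ n := by exact_mod_cast hn0
  have hr1 : 1 ≤ r := by
    by_contra! h
    have := pow_lt_one₀ hr0.le h (n := 5) (by norm_num)
    linarith
  refine momentRatio_le fun D => ?_
  have hN : (0 : ℝ) < n.choose k := by exact_mod_cast Nat.choose_pos hkn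
  have hw : #{j | D j ≠ 0} ≤ n := (card_le_univ _).trans_eq (by simp)
  have hcube := hcube D
  have hpow := hpow D
  have hs := signEsymm_one_eq D
  have hκ : 0 ≤ 1 + signEsymm univ D k / n.choose k := by
    have h := abs_signEsymm_le_choose univ D k
    rw [card_univ, Fintype.card_fin, abs_le] at h
    have : -1 ≤ signEsymm univ D k / n.choose k := by
      rw [le_div_iff₀ hN]
      linarith
    linarith
  set w := #{j | D j ≠ 0}
  set s := signEsymm univ D 1
  set κ := signEsymm univ D k / n.choose k
  have hW : (0 : ℝ) < n.choose w := by exact_mod_cast Nat.choose_pos hw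
  have hratio : (0 : ℝ) ≤ 2 ^ n / n.choose w := by positivity
  have hq : √(n : ℝ) ≤ r ^ 3 := by
    rw [Real.sqrt_le_left (by positivity), ← hrn, ← pow_mul]
    exact pow_le_pow_right₀ hr1 (by norm_num)
  have hexp : (1 + κ) ^ ⌊c * n⌋₊ ≤ Real.exp (n * (C * ((|s| + √n) / n) ^ 3)) :=
    one_add_pow_floor_le_exp hκ hc1 (by positivity) hcube
  rw [add_mul]
  have hA := Real.exp_pos (8 * C / r)
  have hB : 0 ≤ Real.exp (-(1 / 4 * r)) * (2 ^ n / n.choose w) := by positivity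
  have hE : 0 ≤ Real.exp (-(η / 2 * n)) * (2 ^ n / n.choose w) := by positivity
  rcases le_or_gt |s| (r ^ 3) with hsr | hsr
  · refine hexp.trans (le_trans ?_ (le_add_of_nonneg_right (add_nonneg hB hE)))
    gcongr
    calc n * (C * ((|s| + √n) / n) ^ 3) ≤ n * (C * ((r ^ 3 + r ^ 3) / n) ^ 3) := by gcongr
      _ = 8 * C / r := by
        rw [← hrn]
        field_simp
        ring
  rcases le_or_gt |s| (1 / (32 * C) * n) with hsn | hsn
  · refine hexp.trans (le_trans ?_ (le_add_of_nonneg_of_le hA.le (le_add_of_nonneg_right hE)))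
    have hs2 : |s| ^ 2 = (n - 2 * w : ℝ) ^ 2 := by rw [sq_abs, hs]
    have hs0 : 0 < |s| := lt_trans (by positivity) hsr
    have h1 : n * (C * ((|s| + √n) / n) ^ 3) ≤ |s| ^ 2 / (4 * n) := by
      calc n * (C * ((|s| + √n) / n) ^ 3) ≤ n * (C * ((|s| + |s|) / n) ^ 3) := by
            gcongr
            exact hq.trans hsr.le
        _ = 8 * C * |s| ^ 2 / n ^ 2 * |s| := by
            field_simp
            ring
        _ ≤ 8 * C * |s| ^ 2 / n ^ 2 * (1 / (32 * C) * n) := by gcongr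
        _ = _ := by
            field_simp
            norm_num
    have h2 : 1 / 4 * r ≤ |s| ^ 2 / (4 * n) := by
      calc 1 / 4 * r = (r ^ 3) ^ 2 / (4 * n) := by
            rw [← hrn]
            field_simp
        _ ≤ _ := by gcongr
    have h3 : Real.exp (|s| ^ 2 / (2 * n)) ≤ 2 ^ n / n.choose w := by
      have := choose_le_two_pow_mul_exp hw hn0
      rw [← hs2, Real.exp_neg, ← div_eq_mul_inv, le_div_iff₀ (Real.exp_pos _)] at this
      rw [le_div_iff₀ hW]
      linarith
    calc Real.exp (n * (C * ((|s| + √n) / n) ^ 3))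
        ≤ Real.exp (-(1 / 4 * r) + |s| ^ 2 / (2 * n)) := by
          gcongr
          have : |s| ^ 2 / (2 * n) = |s| ^ 2 / (4 * n) + |s| ^ 2 / (4 * n) := by
            field_simp
            norm_num
          linarith
      _ = Real.exp (-(1 / 4 * r)) * Real.exp (|s| ^ 2 / (2 * n)) := Real.exp_add _ _
      _ ≤ _ := by gcongr
  · refine le_trans ?_ (le_add_of_nonneg_of_le hA.le (le_add_of_nonneg_left hB))
    have hz : s / n = 1 - 2 * ((w : ℝ) / n) := by
      rw [hs]
      field_simp
    have hx1 : (w : ℝ) / n ≤ 1 := by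
      rw [div_le_one hn0']
      exact_mod_cast hw
    have hg := hgap (w / n) (by positivity) hx1 (by
      rw [← hz, abs_div, Nat.abs_cast, le_div_iff₀ hn0']
      exact hsn.le)
    rw [← hz] at hg
    refine (one_add_pow_floor_le_of_gap hκ hc0 hc1 (by positivity) hη hpow hg).trans ?_
    gcongr
    rw [le_div_iff₀ hW]
    have := choose_le_exp_neg_Hent hw hn0
    rw [Real.exp_neg, ← one_div, le_div_iff₀ (Real.exp_pos _)] at this
    calc 2 ^ n * Real.exp (n * Hent (w / n)) * n.choose w
        = 2 ^ n * (n.choose w * Real.exp (n * Hent (w / n))) := by ring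
      _ ≤ 2 ^ n * 1 := by gcongr
      _ = _ := mul_one _

theorem tendsto_momentRatio_bound (C : ℝ) {η : ℝ} (hη : 0 < η) :
    Tendsto (fun r : ℝ => Real.exp (C / r) +
      (Real.exp (-(1 / 4 * r)) + Real.exp (-(η * r ^ 5))) * (r ^ 5 + 1)) atTop (nhds 1) := by
  have h1 : Tendsto (fun r : ℝ => Real.exp (C / r)) atTop (nhds 1) := by
    simpa [Function.comp_def] using
      (Real.continuous_exp.tendsto 0).comp (tendsto_const_nhds.div_atTop tendsto_id)
  have hpoly : ∀ b : ℝ, 0 < b → ∀ m : ℕ,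
      Tendsto (fun r : ℝ => Real.exp (-(b * r)) * (r ^ m + 1)) atTop (nhds 0) := by
    intro b hb m
    have key (j : ℕ) : Tendsto (fun r : ℝ => r ^ j * Real.exp (-b * r)) atTop (nhds 0) := by
      simpa using tendsto_rpow_mul_exp_neg_mul_atTop_nhds_zero j b hb
    have := (key m).add (key 0)
    rw [add_zero] at this
    refine this.congr fun r => ?_
    rw [neg_mul]
    ring
  have h3 : Tendsto (fun r : ℝ => Real.exp (-(η * r ^ 5)) * (r ^ 5 + 1)) atTop (nhds 0) := by
    simpa [Function.comp_def] using (hpoly η hη 1).comp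
      (tendsto_pow_atTop (α := ℝ) (n := 5) (by norm_num))
  simpa [add_mul] using h1.add ((hpoly (1 / 4) (by norm_num) 5).add h3)

/-- If `0 < c < 1` and `c < θ_k`, then `P_{n,⌊c·n⌋}(k-XOR-SAT) → 1` as `n → ∞`. -/
theorem tendsto_Psat_of_lt_theta (k : ℕ) (hk : 3 ≤ k) (c : ℝ) (hc0 : 0 < c) (hc1 : c < 1)
    (hθ : ∀ x : ℝ, 0 < x → x < 1 / 2 →
      c * Real.log (1 + (1 - 2 * x) ^ k) < Real.log 2 + Hent x) :
    Tendsto (fun n : ℕ => Psat n ⌊c * n⌋₊ k) atTop (nhds 1) := by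
  obtain ⟨C, η, hη, hQ⟩ := exists_momentRatio_le hk hc0 hc1 hθ
  let root : ℕ → ℝ := fun n => (n : ℝ) ^ (1 / 5 : ℝ)
  have hroot : Tendsto root atTop atTop :=
    (tendsto_rpow_atTop (by norm_num)).comp tendsto_natCast_atTop_atTop
  have hroot5 : ∀ n, root n ^ 5 = n := fun n => by
    simp only [root]
    rw [← Real.rpow_natCast, ← Real.rpow_mul (Nat.cast_nonneg n)]
    norm_num
  have hlim := ((tendsto_momentRatio_bound C hη).comp hroot).inv₀ one_ne_zero
  rw [inv_one] at hlim
  refine tendsto_of_tendsto_of_tendsto_of_le_of_le' hlim tendsto_const_nhds ?_ ?_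
  · filter_upwards [hQ, hroot.eventually_gt_atTop 0, eventually_ge_atTop k] with n hn hr hkn
    have h1 := hn (root n) hr (hroot5 n)
    have h2 := one_le_Psat_mul_momentRatio (L := ⌊c * n⌋₊) hkn
    have hP : 0 ≤ Psat n ⌊c * n⌋₊ k := by
      unfold Psat
      positivity
    simp only [Function.comp_apply, hroot5]
    rw [inv_le_iff_one_le_mul₀ (by positivity)]
    exact h2.trans (by gcongr)
  · filter_upwards [eventually_ge_atTop k] with n hkn
    exact Psat_le_one hkn
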